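/- arXiv:2409.17450 — 15 statements merged into one kernel-verified Lean document; each statement's English description precedes it below -/
import Mathlib

section
/- Let Ω be a nonempty convex subset of a real normed vector space X, let f : Ω → ℝ be a real-valued convex function, let I be an interval of ℝ containing f(Ω), and let φ : ℝ → ℝ ∪ {∞} be σ-quasiconvex and nondecreasing on I (σ ≥ 0). Suppose there exists ℓ ≥ 0 such that ℓ·‖x − u‖ ≤ |f(x) − f(u)| for all x, u ∈ Ω. Then the composition φ ∘ f is σℓ²-quasiconvex on Ω. -/
/-- A function `f` with values in `ℝ ∪ {∞}` (modeled as `EReal`) is `σ`-quasiconvex on a set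
`Ω` if `f (λx + (1-λ)y) ≤ max (f x) (f y) - (σ/2)·λ(1-λ)·‖x-y‖²` for all `x, y ∈ Ω` and
`0 < λ < 1`. -/
def SQuasiconvexOn {X : Type*} [NormedAddCommGroup X] [NormedSpace ℝ X]
    (σ : ℝ) (Ω : Set X) (f : X → EReal) : Prop :=
  ∀ x ∈ Ω, ∀ y ∈ Ω, ∀ l : ℝ, 0 < l → l < 1 →
    f (l • x + (1 - l) • y) ≤
      max (f x) (f y) - ((σ / 2 * (l * (1 - l)) * ‖x - y‖ ^ 2 : ℝ) : EReal)

theorem stmt_0 {X : Type*} [NormedAddCommGroup X] [NormedSpace ℝ X]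
    {Ω : Set X} (hΩne : Ω.Nonempty) (hΩconv : Convex ℝ Ω)
    {f : X → ℝ} (hf : ConvexOn ℝ Ω f)
    {I : Set ℝ} (hI : I.OrdConnected) (hfI : f '' Ω ⊆ I)
    {φ : ℝ → EReal} {σ : ℝ} (hσ : 0 ≤ σ)
    (hφqc : SQuasiconvexOn σ I φ) (hφmono : MonotoneOn φ I)
    {ℓ : ℝ} (hℓ : 0 ≤ ℓ)
    (hexp : ∀ x ∈ Ω, ∀ u ∈ Ω, ℓ * ‖x - u‖ ≤ |f x - f u|) :
    SQuasiconvexOn (σ * ℓ ^ 2) Ω (fun x => φ (f x)) := by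
  intro x hx y hy l hl0 hl1
  have hl1' : 0 ≤ 1 - l := sub_nonneg.2 hl1.le
  have hfx : f x ∈ I := hfI ⟨x, hx, rfl⟩
  have hfy : f y ∈ I := hfI ⟨y, hy, rfl⟩
  have hz : l • x + (1 - l) • y ∈ Ω := hΩconv hx hy hl0.le hl1' (by ring)
  have ht : l • f x + (1 - l) • f y ∈ I := hI.convex hfx hfy hl0.le hl1' (by ring)
  have hle : f (l • x + (1 - l) • y) ≤ l • f x + (1 - l) • f y :=
    hf.2 hx hy hl0.le hl1' (by ring)
  have hsq : (ℓ * ‖x - y‖) ^ 2 ≤ ‖f x - f y‖ ^ 2 := by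
    rw [Real.norm_eq_abs]
    exact pow_le_pow_left₀ (by positivity) (hexp x hx y hy) 2
  have hmod : σ * ℓ ^ 2 / 2 * (l * (1 - l)) * ‖x - y‖ ^ 2 ≤
      σ / 2 * (l * (1 - l)) * ‖f x - f y‖ ^ 2 :=
    calc σ * ℓ ^ 2 / 2 * (l * (1 - l)) * ‖x - y‖ ^ 2
        = σ / 2 * (l * (1 - l)) * (ℓ * ‖x - y‖) ^ 2 := by ring
      _ ≤ _ := mul_le_mul_of_nonneg_left hsq (by positivity)
  calc φ (f (l • x + (1 - l) • y)) ≤ φ (l • f x + (1 - l) • f y) :=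
        hφmono (hfI ⟨_, hz, rfl⟩) ht hle
    _ ≤ _ := hφqc (f x) hfx (f y) hfy l hl0 hl1
    _ ≤ _ := EReal.sub_le_sub le_rfl (EReal.coe_le_coe_iff.2 hmod)
end

section
/- Let X and Y be real normed vector spaces, let Ω ⊆ X and Θ ⊆ Y be nonempty convex sets, let f : Θ → ℝ be σ-quasiconvex (σ ≥ 0), and let F : Ω ⇉ Θ be a set-valued map whose graph {(x,y) : y ∈ F(x)} is a convex subset of X × Y and which is γ-expansive for some γ > 0, i.e., ‖x₁ − x₂‖ ≤ γ‖y₁ − y₂‖ whenever y₁ ∈ F(x₁) and y₂ ∈ F(x₂). Define the optimal value function μ(x) = inf{ f(y) : y ∈ F(x) } for x ∈ Ω (with inf ∅ = ∞), and assume μ(x) > −∞ for every x ∈ Ω. Then μ is (σ/γ²)-quasiconvex on Ω. -/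
theorem stmt_2 {X Y : Type*} [NormedAddCommGroup X] [NormedSpace ℝ X]
    [NormedAddCommGroup Y] [NormedSpace ℝ Y]
    {Ω : Set X} {Θ : Set Y} (hΩne : Ω.Nonempty) (hΩconv : Convex ℝ Ω)
    (hΘne : Θ.Nonempty) (hΘconv : Convex ℝ Θ)
    {f : Y → ℝ} {σ : ℝ} (hσ : 0 ≤ σ)
    (hf : SQuasiconvexOn σ Θ (fun y => (f y : EReal)))
    (F : X → Set Y) (hFΘ : ∀ x ∈ Ω, F x ⊆ Θ)
    (hgraph : Convex ℝ {p : X × Y | p.1 ∈ Ω ∧ p.2 ∈ F p.1})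
    {γ : ℝ} (hγ : 0 < γ)
    (hexp : ∀ x₁ ∈ Ω, ∀ x₂ ∈ Ω, ∀ y₁ ∈ F x₁, ∀ y₂ ∈ F x₂,
      ‖x₁ - x₂‖ ≤ γ * ‖y₁ - y₂‖)
    (μ : X → EReal) (hμ : ∀ x, μ x = ⨅ y ∈ F x, (f y : EReal))
    (hμbot : ∀ x ∈ Ω, ⊥ < μ x) :
    SQuasiconvexOn (σ / γ ^ 2) Ω μ := by
  intro x₁ hx₁ x₂ hx₂ l hl0 hl1
  rw [EReal.le_sub_iff_add_le (.inl (EReal.coe_ne_bot _)) (.inl (EReal.coe_ne_top _))]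
  refine le_of_forall_gt_imp_ge_of_dense fun r hr => ?_
  obtain ⟨hr₁, hr₂⟩ := max_lt_iff.1 hr
  simp only [hμ, iInf_lt_iff] at hr₁ hr₂
  obtain ⟨y₁, hy₁, hfy₁⟩ := hr₁
  obtain ⟨y₂, hy₂, hfy₂⟩ := hr₂
  have hmem : l • y₁ + (1 - l) • y₂ ∈ F (l • x₁ + (1 - l) • x₂) :=
    (hgraph (x := (x₁, y₁)) ⟨hx₁, hy₁⟩ (y := (x₂, y₂)) ⟨hx₂, hy₂⟩ hl0.le
      (sub_nonneg.2 hl1.le) (add_sub_cancel l 1)).2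
  have hfy : f (l • y₁ + (1 - l) • y₂) ≤
      max (f y₁) (f y₂) - σ / 2 * (l * (1 - l)) * ‖y₁ - y₂‖ ^ 2 := by
    have h := hf y₁ (hFΘ x₁ hx₁ hy₁) y₂ (hFΘ x₂ hx₂ hy₂) l hl0 hl1
    simp only [← EReal.coe_strictMono.monotone.map_max, ← EReal.coe_sub] at h
    exact EReal.coe_le_coe_iff.1 h
  have hnorm : ‖x₁ - x₂‖ ^ 2 / γ ^ 2 ≤ ‖y₁ - y₂‖ ^ 2 := by
    rw [div_le_iff₀' (by positivity), ← mul_pow]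
    exact pow_le_pow_left₀ (norm_nonneg _) (hexp x₁ hx₁ x₂ hx₂ y₁ hy₁ y₂ hy₂) 2
  have hmodulus : σ / γ ^ 2 / 2 * (l * (1 - l)) * ‖x₁ - x₂‖ ^ 2 ≤
      σ / 2 * (l * (1 - l)) * ‖y₁ - y₂‖ ^ 2 := by
    have hl : 0 ≤ 1 - l := sub_nonneg.2 hl1.le
    calc σ / γ ^ 2 / 2 * (l * (1 - l)) * ‖x₁ - x₂‖ ^ 2
        = σ / 2 * (l * (1 - l)) * (‖x₁ - x₂‖ ^ 2 / γ ^ 2) := by ring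
      _ ≤ _ := mul_le_mul_of_nonneg_left hnorm (by positivity)
  have hμle : μ (l • x₁ + (1 - l) • x₂) ≤ (f (l • y₁ + (1 - l) • y₂) : EReal) := by
    rw [hμ]
    exact iInf₂_le _ hmem
  calc μ (l • x₁ + (1 - l) • x₂) +
        ((σ / γ ^ 2 / 2 * (l * (1 - l)) * ‖x₁ - x₂‖ ^ 2 : ℝ) : EReal)
      ≤ (f (l • y₁ + (1 - l) • y₂) : EReal) +
        ((σ / γ ^ 2 / 2 * (l * (1 - l)) * ‖x₁ - x₂‖ ^ 2 : ℝ) : EReal) := by gcongr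
    _ ≤ ((max (f y₁) (f y₂) : ℝ) : EReal) := by
      rw [← EReal.coe_add, EReal.coe_le_coe_iff]
      linarith
    _ ≤ r := by
      rw [EReal.coe_strictMono.monotone.map_max]
      exact max_le hfy₁.le hfy₂.le
end

section
/- Let X and Y be real normed vector spaces, let f : Y → ℝ be a σ-quasiconvex function (σ ≥ 0), let A : Y → X be a nonzero continuous linear map, let b ∈ X, and set B(z) = A(z) + b for z ∈ Y. Let Ω be a nonempty convex subset of B(Y) and define μ(x) = inf{ f(y) : y ∈ Y, B(y) = x } for x ∈ Ω. If μ(x) > −∞ for all x ∈ Ω, then μ is (σ/‖A‖²)-quasiconvex on Ω, where ‖A‖ is the operator norm of A. -/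
theorem stmt_3 {X Y : Type*} [NormedAddCommGroup X] [NormedSpace ℝ X]
    [NormedAddCommGroup Y] [NormedSpace ℝ Y]
    {f : Y → ℝ} {σ : ℝ} (hσ : 0 ≤ σ)
    (hf : SQuasiconvexOn σ Set.univ (fun y => (f y : EReal)))
    (A : Y →L[ℝ] X) (hA : A ≠ 0) (b : X)
    {Ω : Set X} (hΩne : Ω.Nonempty) (hΩconv : Convex ℝ Ω)
    (hΩran : Ω ⊆ Set.range fun z => A z + b)
    (μ : X → EReal) (hμ : ∀ x, μ x = ⨅ y ∈ {y : Y | A y + b = x}, (f y : EReal))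
    (hμbot : ∀ x ∈ Ω, ⊥ < μ x) :
    SQuasiconvexOn (σ / ‖A‖ ^ 2) Ω μ := by
  intro x _ y _ l hl0 hl1
  rw [EReal.le_sub_iff_add_le (Or.inl (EReal.coe_ne_bot _)) (Or.inl (EReal.coe_ne_top _))]
  by_contra! hlt
  obtain ⟨hx, hy⟩ := max_lt_iff.1 hlt
  rw [hμ x] at hx
  rw [hμ y] at hy
  simp only [iInf_lt_iff] at hx hy
  obtain ⟨u, hu, hfu⟩ := hx
  obtain ⟨v, hv, hfv⟩ := hy
  rw [Set.mem_ofPred_eq] at hu hv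
  have hAw : A (l • u + (1 - l) • v) + b = l • x + (1 - l) • y := by
    rw [← hu, ← hv, map_add, map_smul, map_smul]
    module
  have hμw : μ (l • x + (1 - l) • y) ≤ f (l • u + (1 - l) • v) := by
    rw [hμ]
    exact iInf₂_le (f := fun w (_ : w ∈ {w : Y | A w + b = _}) => (f w : EReal)) _ hAw
  have hxy : ‖x - y‖ ≤ ‖A‖ * ‖u - v‖ := by
    rw [← hu, ← hv, add_sub_add_right_eq_sub, ← map_sub]
    exact A.le_opNorm _
  have hnorm : 0 < ‖A‖ := norm_pos_iff.2 hA
  have hmod : σ / ‖A‖ ^ 2 / 2 * (l * (1 - l)) * ‖x - y‖ ^ 2 ≤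
      σ / 2 * (l * (1 - l)) * ‖u - v‖ ^ 2 := by
    have hl : 0 ≤ l * (1 - l) := mul_nonneg hl0.le (sub_nonneg.2 hl1.le)
    calc
      _ ≤ σ / ‖A‖ ^ 2 / 2 * (l * (1 - l)) * (‖A‖ * ‖u - v‖) ^ 2 := by gcongr
      _ = _ := by field_simp
  have hfw := hf u (Set.mem_univ u) v (Set.mem_univ v) l hl0 hl1
  rw [EReal.le_sub_iff_add_le (Or.inl (EReal.coe_ne_bot _)) (Or.inl (EReal.coe_ne_top _))] at hfw
  exact lt_irrefl _ <| ((add_le_add hμw (EReal.coe_le_coe_iff.2 hmod)).trans hfw).trans_lt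
    (max_lt hfu hfv)
end

section
/- Let X and Y be real normed vector spaces, let A : X → Y be linear, let b ∈ Y, and set B(x) = A(x) + b. Suppose there exists γ > 0 such that ‖x‖ ≤ γ‖A(x)‖ for all x ∈ X. Let Ω be a nonempty convex subset of X and suppose f : B(Ω) → ℝ ∪ {∞} is σ-quasiconvex on Θ := B(Ω) (σ ≥ 0). Then the composition f ∘ B is (σ/γ²)-quasiconvex on Ω. -/
theorem stmt_4 {X Y : Type*} [NormedAddCommGroup X] [NormedSpace ℝ X]
    [NormedAddCommGroup Y] [NormedSpace ℝ Y]
    (A : X →ₗ[ℝ] Y) (b : Y) {γ : ℝ} (hγ : 0 < γ)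
    (hexp : ∀ x : X, ‖x‖ ≤ γ * ‖A x‖)
    {Ω : Set X} (hΩne : Ω.Nonempty) (hΩconv : Convex ℝ Ω)
    {f : Y → EReal} {σ : ℝ} (hσ : 0 ≤ σ)
    (hf : SQuasiconvexOn σ ((fun x => A x + b) '' Ω) f) :
    SQuasiconvexOn (σ / γ ^ 2) Ω (fun x => f (A x + b)) := by
  intro x hx y hy l hl0 hl1
  have hB : A (l • x + (1 - l) • y) + b = l • (A x + b) + (1 - l) • (A y + b) := by
    rw [map_add, map_smul, map_smul]
    module
  have hsub : A x + b - (A y + b) = A (x - y) := by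
    rw [map_sub]
    abel
  have hfB := hf _ ⟨x, hx, rfl⟩ _ ⟨y, hy, rfl⟩ l hl0 hl1
  simp only [hsub, ← hB] at hfB
  refine hfB.trans (EReal.sub_le_sub le_rfl (EReal.coe_le_coe_iff.2 ?_))
  have hl : 0 ≤ l * (1 - l) := mul_nonneg hl0.le (sub_nonneg.2 hl1.le)
  calc
    σ / γ ^ 2 / 2 * (l * (1 - l)) * ‖x - y‖ ^ 2
      ≤ σ / γ ^ 2 / 2 * (l * (1 - l)) * (γ * ‖A (x - y)‖) ^ 2 := by
        gcongr
        exact hexp _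
    _ = σ / 2 * (l * (1 - l)) * ‖A (x - y)‖ ^ 2 := by
        field_simp
end

section
/- Let X be a real normed vector space and let f₁, f₂ : X → ℝ ∪ {∞}. Equip X × X with the sum norm ‖(x₁, x₂)‖ = ‖x₁‖ + ‖x₂‖, and suppose the function f(x₁, x₂) = f₁(x₁) + f₂(x₂) is σ-quasiconvex on X × X (σ ≥ 0). Then the infimal convolution (f₁ □ f₂)(x) = inf{ f₁(x₁) + f₂(x₂) : x₁ + x₂ = x } is σ-quasiconvex on X, provided (f₁ □ f₂)(x) > −∞ for all x ∈ X. -/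
theorem stmt_5 {X : Type*} [NormedAddCommGroup X] [NormedSpace ℝ X]
    (f₁ f₂ : X → EReal) {σ : ℝ} (hσ : 0 ≤ σ)
    (hf : ∀ x₁ x₂ u₁ u₂ : X, ∀ l : ℝ, 0 < l → l < 1 →
      f₁ (l • x₁ + (1 - l) • u₁) + f₂ (l • x₂ + (1 - l) • u₂) ≤
        max (f₁ x₁ + f₂ x₂) (f₁ u₁ + f₂ u₂) -
          ((σ / 2 * (l * (1 - l)) * (‖x₁ - u₁‖ + ‖x₂ - u₂‖) ^ 2 : ℝ) : EReal))
    (g : X → EReal)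
    (hg : ∀ x, g x = ⨅ p ∈ {p : X × X | p.1 + p.2 = x}, (f₁ p.1 + f₂ p.2))
    (hgbot : ∀ x, ⊥ < g x) :
    SQuasiconvexOn σ Set.univ g := by
  intro x _ y _ l hl0 hl1
  have hl : 0 ≤ σ / 2 * (l * (1 - l)) :=
    mul_nonneg (by linarith) (mul_nonneg hl0.le (by linarith))
  rw [EReal.le_sub_iff_add_le (.inl (EReal.coe_ne_bot _)) (.inl (EReal.coe_ne_top _))]
  by_contra! hlt
  obtain ⟨hx, hy⟩ := max_lt_iff.1 hlt
  rw [hg x] at hx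
  rw [hg y] at hy
  simp only [iInf_lt_iff] at hx hy
  obtain ⟨⟨x₁, x₂⟩, hxs, hx⟩ := hx
  obtain ⟨⟨y₁, y₂⟩, hys, hy⟩ := hy
  simp only [Set.mem_ofPred_eq] at hxs hys hx hy
  have hgz : g (l • x + (1 - l) • y) ≤
      f₁ (l • x₁ + (1 - l) • y₁) + f₂ (l • x₂ + (1 - l) • y₂) := by
    rw [hg]
    refine iInf₂_le (l • x₁ + (1 - l) • y₁, l • x₂ + (1 - l) • y₂) ?_
    simp only [Set.mem_ofPred_eq, ← hxs, ← hys]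
    module
  have hnorm : ‖x - y‖ ≤ ‖x₁ - y₁‖ + ‖x₂ - y₂‖ := by
    rw [← hxs, ← hys, add_sub_add_comm]
    exact norm_add_le _ _
  have hmod : σ / 2 * (l * (1 - l)) * ‖x - y‖ ^ 2 ≤
      σ / 2 * (l * (1 - l)) * (‖x₁ - y₁‖ + ‖x₂ - y₂‖) ^ 2 := by gcongr
  have hle := (hgz.trans (hf x₁ x₂ y₁ y₂ l hl0 hl1)).trans
    (EReal.sub_le_sub le_rfl (EReal.coe_le_coe_iff.2 hmod))
  rw [EReal.le_sub_iff_add_le (.inl (EReal.coe_ne_bot _)) (.inl (EReal.coe_ne_top _))] at hle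
  exact (hle.trans_lt (max_lt hx hy)).false
end

section
/- Let X be a real normed vector space, Ω a nonempty convex subset of X, σ ≥ 0, and f : Ω → ℝ ∪ {∞}. (i) If f is σ-quasiconvex on Ω, then for any x, u ∈ Ω with x ≠ u, the function φ(t) = f(t·x + (1−t)·u) is σ‖x−u‖²-quasiconvex on [0, 1]. (ii) Moreover, f is σ-quasiconvex on Ω if and only if for every x, u ∈ Ω with x ≠ u, the function ψ(t) = f(u + (t/‖x−u‖)·(x−u)) is σ-quasiconvex on the interval [0, ‖x−u‖]. -/
/-- Precomposing a `σ`-quasiconvex function with a map that preserves convex combinations and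
scales distances by `c` gives a `σ * c ^ 2`-quasiconvex function. -/
theorem SQuasiconvexOn.comp_of_scaling {X Y : Type*} [NormedAddCommGroup X] [NormedSpace ℝ X]
    [NormedAddCommGroup Y] [NormedSpace ℝ Y] {σ c : ℝ} {Ω : Set X} {S : Set Y} {f : X → EReal}
    {g : Y → X} (hf : SQuasiconvexOn σ Ω f) (hmaps : Set.MapsTo g S Ω)
    (hcomb : ∀ a b (l : ℝ), g (l • a + (1 - l) • b) = l • g a + (1 - l) • g b)
    (hdist : ∀ a b, ‖g a - g b‖ = c * ‖a - b‖) :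
    SQuasiconvexOn (σ * c ^ 2) S fun t => f (g t) := by
  intro a ha b hb l hl hl1
  have h := hf (g a) (hmaps ha) (g b) (hmaps hb) l hl hl1
  rw [← hcomb, hdist] at h
  convert h using 3
  ring

theorem stmt_6 {X : Type*} [NormedAddCommGroup X] [NormedSpace ℝ X]
    {Ω : Set X} (hΩne : Ω.Nonempty) (hΩconv : Convex ℝ Ω)
    (f : X → EReal) {σ : ℝ} (hσ : 0 ≤ σ) :
    (SQuasiconvexOn σ Ω f → ∀ x ∈ Ω, ∀ u ∈ Ω, x ≠ u →
        SQuasiconvexOn (σ * ‖x - u‖ ^ 2) (Set.Icc (0 : ℝ) 1)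
          fun t => f (t • x + (1 - t) • u)) ∧
      (SQuasiconvexOn σ Ω f ↔ ∀ x ∈ Ω, ∀ u ∈ Ω, x ≠ u →
        SQuasiconvexOn σ (Set.Icc (0 : ℝ) ‖x - u‖)
          fun t => f (u + (t / ‖x - u‖) • (x - u))) := by
  have hseg : SQuasiconvexOn σ Ω f → ∀ x ∈ Ω, ∀ u ∈ Ω, x ≠ u →
      SQuasiconvexOn (σ * ‖x - u‖ ^ 2) (Set.Icc (0 : ℝ) 1)
        fun t => f (t • x + (1 - t) • u) := by
    intro hf x hx u hu _
    refine hf.comp_of_scaling (g := fun t : ℝ => t • x + (1 - t) • u)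
      (fun t ht => hΩconv hx hu ht.1 (sub_nonneg.2 ht.2) (by ring)) (fun a b l => ?_)
      (fun a b => ?_)
    · simp only [smul_eq_mul]
      module
    · rw [show a • x + (1 - a) • u - (b • x + (1 - b) • u) = (a - b) • (x - u) by module,
        norm_smul, mul_comm]
  refine ⟨hseg, fun hf x hx u hu hxu => ?_, fun h x hx u hu l hl hl1 => ?_⟩
  · have hd : 0 < ‖x - u‖ := norm_pos_iff.2 (sub_ne_zero.2 hxu)
    have h := (hseg hf x hx u hu hxu).comp_of_scaling (S := Set.Icc (0 : ℝ) ‖x - u‖)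
      (g := fun t : ℝ => t / ‖x - u‖) (c := ‖x - u‖⁻¹)
      (fun t ht => ⟨div_nonneg ht.1 hd.le, (div_le_one hd).2 ht.2⟩)
      (fun a b l => by simp only [smul_eq_mul]; ring)
      (fun a b => by rw [← sub_div, norm_div, norm_norm, div_eq_inv_mul])
    have hσ' : σ * ‖x - u‖ ^ 2 * ‖x - u‖⁻¹ ^ 2 = σ := by field_simp
    rw [hσ'] at h
    convert h using 3
    module
  · rcases eq_or_ne x u with rfl | hxu
    · simp [← add_smul]
    · have hd : 0 < ‖x - u‖ := norm_pos_iff.2 (sub_ne_zero.2 hxu)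
      have h' := h x hx u hu hxu ‖x - u‖ ⟨hd.le, le_rfl⟩ 0 ⟨le_rfl, hd.le⟩ l hl hl1
      have hpt : u + l • (x - u) = l • x + (1 - l) • u := by module
      simpa [hd.ne', hpt] using h'
end

section
/- Let X and Y be real normed vector spaces, let Ω ⊆ X and Θ ⊆ Y be nonempty convex sets, and equip X × Y with the norm ‖(x, y)‖ = max{‖x‖, ‖y‖}. Let f : Ω × Θ → ℝ ∪ {∞} be σ-quasiconvex (σ ≥ 0) with respect to this product norm, and let F : Ω ⇉ Θ be a set-valued map whose graph is convex. Define v(x) = inf_{y ∈ F(x)} f(x, y) for x ∈ Ω (with inf ∅ = ∞), and assume v(x) > −∞ for all x ∈ Ω. Then v is σ-quasiconvex on Ω. -/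
theorem stmt_7 {X Y : Type*} [NormedAddCommGroup X] [NormedSpace ℝ X]
    [NormedAddCommGroup Y] [NormedSpace ℝ Y]
    {Ω : Set X} {Θ : Set Y} (hΩne : Ω.Nonempty) (hΩconv : Convex ℝ Ω)
    (hΘne : Θ.Nonempty) (hΘconv : Convex ℝ Θ)
    (f : X × Y → EReal) {σ : ℝ} (hσ : 0 ≤ σ)
    (hf : SQuasiconvexOn σ (Ω ×ˢ Θ) f)
    (F : X → Set Y) (hFΘ : ∀ x ∈ Ω, F x ⊆ Θ)
    (hgraph : Convex ℝ {p : X × Y | p.1 ∈ Ω ∧ p.2 ∈ F p.1})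
    (v : X → EReal) (hv : ∀ x, v x = ⨅ y ∈ F x, f (x, y))
    (hvbot : ∀ x ∈ Ω, ⊥ < v x) :
    SQuasiconvexOn σ Ω v := by
  intro x hx y hy l hl0 hl1
  rw [EReal.le_sub_iff_add_le (.inl (EReal.coe_ne_bot _)) (.inl (EReal.coe_ne_top _))]
  refine le_of_forall_gt_imp_ge_of_dense fun a ha => ?_
  rw [← EReal.le_sub_iff_add_le (.inl (EReal.coe_ne_bot _)) (.inl (EReal.coe_ne_top _))]
  obtain ⟨hxa, hya⟩ := max_lt_iff.1 ha
  simp only [hv, iInf_lt_iff] at hxa hya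
  obtain ⟨p, hp, hpa⟩ := hxa
  obtain ⟨q, hq, hqa⟩ := hya
  have hmem : l • p + (1 - l) • q ∈ F (l • x + (1 - l) • y) :=
    (hgraph (x := (x, p)) ⟨hx, hp⟩ (y := (y, q)) ⟨hy, hq⟩ hl0.le (sub_nonneg.2 hl1.le)
      (add_sub_cancel l 1)).2
  have hnorm : ‖x - y‖ ≤ ‖(x, p) - (y, q)‖ := norm_fst_le ((x, p) - (y, q))
  have hcoef : 0 ≤ σ / 2 * (l * (1 - l)) :=
    mul_nonneg (by linarith) (mul_nonneg hl0.le (sub_nonneg.2 hl1.le))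
  calc v (l • x + (1 - l) • y)
      ≤ f (l • (x, p) + (1 - l) • (y, q)) := by
        rw [hv]
        exact iInf₂_le (l • p + (1 - l) • q) hmem
    _ ≤ _ := hf (x, p) ⟨hx, hFΘ x hx hp⟩ (y, q) ⟨hy, hFΘ y hy hq⟩ l hl0 hl1
    _ ≤ _ := EReal.sub_le_sub (max_lt hpa hqa).le (EReal.coe_le_coe_iff.2 (by gcongr))
end

section
/- Let X and Y be real normed vector spaces, let Ω ⊆ X and Θ ⊆ Y be nonempty convex sets, and equip X × Y with the norm ‖(x, y)‖ = max{‖x‖, ‖y‖}. Let f : Ω × Θ → ℝ ∪ {∞} be σ-quasiconvex (σ ≥ 0) with respect to this product norm, and let F : Ω ⇉ Θ be an affine process with F(x) ≠ ∅ for every x ∈ Ω, i.e., F(λx + (1−λ)y) ⊆ λF(x) + (1−λ)F(y) for all x, y ∈ Ω and 0 < λ < 1. Then the function V(x) = sup{ f(x, y) : y ∈ F(x) } is σ-quasiconvex on Ω. -/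
open Pointwise in
theorem stmt_8 {X Y : Type*} [NormedAddCommGroup X] [NormedSpace ℝ X]
    [NormedAddCommGroup Y] [NormedSpace ℝ Y]
    {Ω : Set X} {Θ : Set Y} (hΩne : Ω.Nonempty) (hΩconv : Convex ℝ Ω)
    (hΘne : Θ.Nonempty) (hΘconv : Convex ℝ Θ)
    (f : X × Y → EReal) {σ : ℝ} (hσ : 0 ≤ σ)
    (hf : SQuasiconvexOn σ (Ω ×ˢ Θ) f)
    (F : X → Set Y) (hFΘ : ∀ x ∈ Ω, F x ⊆ Θ)
    (hFne : ∀ x ∈ Ω, (F x).Nonempty)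
    (haff : ∀ x ∈ Ω, ∀ y ∈ Ω, ∀ l : ℝ, 0 < l → l < 1 →
      F (l • x + (1 - l) • y) ⊆ l • F x + (1 - l) • F y)
    (V : X → EReal) (hV : ∀ x, V x = ⨆ y ∈ F x, f (x, y)) :
    SQuasiconvexOn σ Ω V := by
  intro x hx y hy l hl₀ hl₁
  rw [hV (l • x + (1 - l) • y)]
  refine iSup₂_le fun z hz ↦ ?_
  obtain ⟨_, ⟨a, ha, rfl⟩, _, ⟨b, hb, rfl⟩, rfl⟩ := haff x hx y hy l hl₀ hl₁ hz
  have hfV : ∀ u, ∀ v ∈ F u, f (u, v) ≤ V u := fun u v hv ↦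
    (le_iSup₂ (f := fun w (_ : w ∈ F u) ↦ f (u, w)) v hv).trans_eq (hV u).symm
  refine (hf (x, a) ⟨hx, hFΘ x hx ha⟩ (y, b) ⟨hy, hFΘ y hy hb⟩ l hl₀ hl₁).trans
    (EReal.sub_le_sub (max_le_max (hfV x a ha) (hfV y b hb)) (EReal.coe_le_coe_iff.2 ?_))
  have hnorm : ‖x - y‖ ≤ ‖(x, a) - (y, b)‖ := norm_fst_le ((x, a) - (y, b))
  have hl : 0 ≤ 1 - l := sub_nonneg.2 hl₁.le
  gcongr
end

section
/- Let H be a real inner product space and let Ω be a nonempty bounded convex subset of H with Ω ⊆ B(0; r) for some r > 0. Then the norm function f(x) = ‖x‖ is (1/r)-strongly quasiconvex on Ω; in particular, the norm is strongly quasiconvex on every nonempty bounded convex subset of H. -/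
/-- A real-valued function `f` is `σ`-quasiconvex on a set `Ω` if
`f (λx + (1-λ)y) ≤ max (f x) (f y) - (σ/2)·λ(1-λ)·‖x-y‖²` for all `x, y ∈ Ω` and
`0 < λ < 1`. -/
def SQuasiconvexOnR {X : Type*} [NormedAddCommGroup X] [NormedSpace ℝ X]
    (σ : ℝ) (Ω : Set X) (f : X → ℝ) : Prop :=
  ∀ x ∈ Ω, ∀ y ∈ Ω, ∀ l : ℝ, 0 < l → l < 1 →
    f (l • x + (1 - l) • y) ≤
      max (f x) (f y) - σ / 2 * (l * (1 - l)) * ‖x - y‖ ^ 2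

/-- The parallelogram-type identity for the squared norm of a convex combination. -/
theorem norm_sq_convex_combination {H : Type*} [NormedAddCommGroup H] [InnerProductSpace ℝ H]
    (x y : H) (l : ℝ) :
    ‖l • x + (1 - l) • y‖ ^ 2 =
      l * ‖x‖ ^ 2 + (1 - l) * ‖y‖ ^ 2 - l * (1 - l) * ‖x - y‖ ^ 2 := by
  rw [norm_add_sq_real, norm_sub_sq_real, norm_smul, norm_smul, inner_smul_left,
    inner_smul_right, mul_pow, mul_pow, Real.norm_eq_abs, Real.norm_eq_abs, sq_abs, sq_abs]
  simp only [conj_trivial]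
  ring

theorem stmt_9 {H : Type*} [NormedAddCommGroup H] [InnerProductSpace ℝ H]
    {Ω : Set H} (hΩne : Ω.Nonempty) (hΩconv : Convex ℝ Ω)
    {r : ℝ} (hr : 0 < r) (hΩsub : Ω ⊆ Metric.ball 0 r) :
    SQuasiconvexOnR (1 / r) Ω fun x => ‖x‖ := by
  intro x hx y hy l hl0 hl1
  have hxr : ‖x‖ < r := by simpa using hΩsub hx
  have hyr : ‖y‖ < r := by simpa using hΩsub hy
  have hid := norm_sq_convex_combination x y l
  set n := ‖l • x + (1 - l) • y‖
  set M := max ‖x‖ ‖y‖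
  set d := l * (1 - l) * ‖x - y‖ ^ 2 with hd
  have hl1' : 0 < 1 - l := sub_pos.2 hl1
  have hd0 : 0 ≤ d := by positivity
  have hM0 : 0 ≤ M := (norm_nonneg x).trans (le_max_left _ _)
  have hMr : M < r := max_lt hxr hyr
  have hxM : ‖x‖ ^ 2 ≤ M ^ 2 := by gcongr; exact le_max_left _ _
  have hyM : ‖y‖ ^ 2 ≤ M ^ 2 := by gcongr; exact le_max_right _ _
  have hsq : n ^ 2 + d ≤ M ^ 2 := by
    nlinarith [mul_le_mul_of_nonneg_left hxM hl0.le, mul_le_mul_of_nonneg_left hyM hl1'.le]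
  have hnM : n ≤ M := by nlinarith
  have hdiv : d / (2 * r) ≤ M - n := by
    rw [div_le_iff₀ (by positivity)]
    nlinarith [mul_nonneg (sub_nonneg.2 hnM) (by linarith : (0 : ℝ) ≤ 2 * r - M - n)]
  have hrw : 1 / r / 2 * (l * (1 - l)) * ‖x - y‖ ^ 2 = d / (2 * r) := by
    rw [hd]; field_simp
  change n ≤ M - 1 / r / 2 * (l * (1 - l)) * ‖x - y‖ ^ 2
  rw [hrw]
  linarith
end

section
/- Let X be a real Banach space satisfying Assumption (A) for some σ > 0. Then for all x, y ∈ X with ‖x‖ ≤ 1 and ‖y‖ ≤ 1, one has ‖(x + y)/2‖ ≤ max{‖x‖, ‖y‖} − (σ/8)‖x − y‖². -/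
theorem stmt_11 {X : Type*} [NormedAddCommGroup X] [NormedSpace ℝ X] [CompleteSpace X]
    {σ : ℝ} (hσ : 0 < σ)
    (hA : ∀ ε ∈ Set.Icc (0 : ℝ) 2, ∀ x y : X, ‖x‖ ≤ 1 → ‖y‖ ≤ 1 → ε ≤ ‖x - y‖ →
      ‖(2 : ℝ)⁻¹ • (x + y)‖ ≤ 1 - σ / 8 * ε ^ 2) :
    ∀ x y : X, ‖x‖ ≤ 1 → ‖y‖ ≤ 1 →
      ‖(2 : ℝ)⁻¹ • (x + y)‖ ≤ max ‖x‖ ‖y‖ - σ / 8 * ‖x - y‖ ^ 2 := by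
  intro x y hx hy
  set M := max ‖x‖ ‖y‖ with hM
  have hxM : ‖x‖ ≤ M := le_max_left _ _
  have hyM : ‖y‖ ≤ M := le_max_right _ _
  have hM1 : M ≤ 1 := max_le hx hy
  rcases (norm_nonneg x |>.trans hxM).eq_or_lt with h0 | h0
  · have hx0 : x = 0 := norm_le_zero_iff.mp (hxM.trans h0.ge)
    have hy0 : y = 0 := norm_le_zero_iff.mp (hyM.trans h0.ge)
    rw [← h0]
    simp [hx0, hy0]
  have hnorm (z : X) : ‖M⁻¹ • z‖ = ‖z‖ / M := by
    rw [norm_smul, norm_inv, Real.norm_of_nonneg h0.le, inv_mul_eq_div]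
  have hd : ‖x - y‖ / M ≤ 2 := by
    rw [div_le_iff₀ h0]
    linarith [norm_sub_le x y]
  have key := hA (‖x - y‖ / M) ⟨by positivity, hd⟩ (M⁻¹ • x) (M⁻¹ • y)
    (by rw [hnorm]; exact div_le_one_of_le₀ hxM h0.le)
    (by rw [hnorm]; exact div_le_one_of_le₀ hyM h0.le)
    (by rw [← smul_sub, hnorm])
  rw [← smul_add, smul_comm, hnorm, div_le_iff₀ h0] at key
  have hscale : (1 - σ / 8 * (‖x - y‖ / M) ^ 2) * M = M - σ / 8 * (‖x - y‖ ^ 2 / M) := by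
    field_simp
  have hdiv : ‖x - y‖ ^ 2 ≤ ‖x - y‖ ^ 2 / M := le_div_self (by positivity) h0 hM1
  rw [hscale] at key
  exact key.trans (by gcongr)
end

section
/- Let X be a real normed vector space, σ > 0, and Ω ⊆ X a nonempty convex set such that for all x, y ∈ Ω one has ‖(x + y)/2‖ ≤ max{‖x‖, ‖y‖} − (σ/8)‖x − y‖². Then the norm function f(x) = ‖x‖ is (σ/2)-strongly quasiconvex on Ω; that is, for all x, y ∈ Ω and λ ∈ [0, 1], ‖λx + (1−λ)y‖ ≤ max{‖x‖, ‖y‖} − (σ/4)λ(1−λ)‖x − y‖². -/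
/-- By convexity of the norm, a bound at the midpoint of a segment propagates linearly towards
the endpoint `y`. -/
theorem norm_convexComb_le_of_norm_midpoint_le {X : Type*} [NormedAddCommGroup X]
    [NormedSpace ℝ X] {x y : X} {M c l : ℝ} (hy : ‖y‖ ≤ M)
    (hmid : ‖(2 : ℝ)⁻¹ • (x + y)‖ ≤ M - c) (hl₀ : 0 ≤ l) (hl : l ≤ 1 / 2) :
    ‖l • x + (1 - l) • y‖ ≤ M - 2 * l * c := by
  have heq : l • x + (1 - l) • y = (2 * l) • ((2 : ℝ)⁻¹ • (x + y)) + (1 - 2 * l) • y := by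
    module
  calc ‖l • x + (1 - l) • y‖
      ≤ ‖(2 * l) • ((2 : ℝ)⁻¹ • (x + y))‖ + ‖(1 - 2 * l) • y‖ := heq ▸ norm_add_le _ _
    _ = 2 * l * ‖(2 : ℝ)⁻¹ • (x + y)‖ + (1 - 2 * l) * ‖y‖ := by
      rw [norm_smul_of_nonneg (t := 2 * l) (by linarith),
        norm_smul_of_nonneg (t := 1 - 2 * l) (by linarith)]
    _ ≤ 2 * l * (M - c) + (1 - 2 * l) * M := by
      have : 0 ≤ 1 - 2 * l := by linarith
      gcongr
    _ = M - 2 * l * c := by ring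

theorem stmt_12 {X : Type*} [NormedAddCommGroup X] [NormedSpace ℝ X]
    {σ : ℝ} (hσ : 0 < σ) {Ω : Set X} (hΩne : Ω.Nonempty) (hΩconv : Convex ℝ Ω)
    (hmid : ∀ x ∈ Ω, ∀ y ∈ Ω,
      ‖(2 : ℝ)⁻¹ • (x + y)‖ ≤ max ‖x‖ ‖y‖ - σ / 8 * ‖x - y‖ ^ 2) :
    ∀ x ∈ Ω, ∀ y ∈ Ω, ∀ l : ℝ, 0 ≤ l → l ≤ 1 →
      ‖l • x + (1 - l) • y‖ ≤ max ‖x‖ ‖y‖ - σ / 4 * (l * (1 - l)) * ‖x - y‖ ^ 2 := by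
  intro x hx y hy l hl₀ hl₁
  have hc : 0 ≤ σ / 4 * ‖x - y‖ ^ 2 := by positivity
  rcases le_total l (1 / 2) with hl | hl
  · have h := norm_convexComb_le_of_norm_midpoint_le (le_max_right _ _) (hmid x hx y hy) hl₀ hl
    nlinarith [mul_nonneg (sq_nonneg l) hc]
  · have h := norm_convexComb_le_of_norm_midpoint_le (x := y) (y := x) (l := 1 - l)
      (le_max_left _ _) (add_comm x y ▸ hmid x hx y hy) (by linarith) (by linarith)
    rw [sub_sub_cancel, add_comm] at h
    nlinarith [mul_nonneg (sq_nonneg (1 - l)) hc]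
end

section
/- Let X be a real Banach space satisfying Assumption (A) for some σ > 0. Then the norm function f(x) = ‖x‖ is strongly quasiconvex on every nonempty bounded convex subset of X; more precisely, f is (σ/2)-strongly quasiconvex on the closed unit ball, and if Ω is a nonempty convex set with ‖x‖ ≤ M for all x ∈ Ω (M > 0), then f is (σ/(2M))-strongly quasiconvex on Ω. -/
/-- Rescaled midpoint inequality: a quadratic modulus of convexity on the unit ball controls
midpoints in the ball of radius `M`. -/
theorem norm_midpoint_le_of_quadratic_modulus {X : Type*} [NormedAddCommGroup X]
    [NormedSpace ℝ X] {σ : ℝ} (hσ : 0 < σ)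
    (hA : ∀ ε ∈ Set.Icc (0 : ℝ) 2, ∀ x y : X, ‖x‖ ≤ 1 → ‖y‖ ≤ 1 → ε ≤ ‖x - y‖ →
      ‖(2 : ℝ)⁻¹ • (x + y)‖ ≤ 1 - σ / 8 * ε ^ 2)
    {m M : ℝ} (hm : 0 < m) (hmM : m ≤ M) {x y : X} (hx : ‖x‖ ≤ m) (hy : ‖y‖ ≤ m) :
    ‖(2 : ℝ)⁻¹ • (x + y)‖ ≤ m - σ / (8 * M) * ‖x - y‖ ^ 2 := by
  have norm_scale (z : X) : ‖m⁻¹ • z‖ = ‖z‖ / m := by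
    rw [norm_smul, Real.norm_of_nonneg (inv_nonneg.2 hm.le), inv_mul_eq_div]
  have hd : ‖x - y‖ / m ≤ 2 := by
    rw [div_le_iff₀ hm]
    linarith [norm_sub_le x y]
  have h := hA (‖x - y‖ / m) ⟨by positivity, hd⟩ (m⁻¹ • x) (m⁻¹ • y)
    (by rwa [norm_scale, div_le_one hm]) (by rwa [norm_scale, div_le_one hm])
    (by rw [← smul_sub, norm_scale])
  rw [← smul_add, smul_comm, norm_scale, div_le_iff₀ hm] at h
  have hle : σ / (8 * M) * ‖x - y‖ ^ 2 ≤ σ / (8 * m) * ‖x - y‖ ^ 2 := by gcongr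
  have heq : (1 - σ / 8 * (‖x - y‖ / m) ^ 2) * m = m - σ / (8 * m) * ‖x - y‖ ^ 2 := by
    field_simp
  linarith

/-- Under a quadratic modulus of convexity, the norm is `σ / (2 * M)`-quasiconvex on every set
bounded by `M`. -/
theorem sQuasiconvexOnR_norm_of_quadratic_modulus {X : Type*} [NormedAddCommGroup X]
    [NormedSpace ℝ X] {σ : ℝ} (hσ : 0 < σ)
    (hA : ∀ ε ∈ Set.Icc (0 : ℝ) 2, ∀ x y : X, ‖x‖ ≤ 1 → ‖y‖ ≤ 1 → ε ≤ ‖x - y‖ →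
      ‖(2 : ℝ)⁻¹ • (x + y)‖ ≤ 1 - σ / 8 * ε ^ 2)
    {Ω : Set X} {M : ℝ} (hM : 0 < M) (hΩ : ∀ x ∈ Ω, ‖x‖ ≤ M) :
    SQuasiconvexOnR (σ / (2 * M)) Ω fun x => ‖x‖ := by
  intro x hx y hy l hl0 hl1
  wlog hl : l ≤ 1 / 2 generalizing x y l
  · have h := this y hy x hx (1 - l) (by linarith) (by linarith) (by linarith)
    rw [sub_sub_cancel, add_comm, max_comm, norm_sub_rev, mul_comm (1 - l)] at h
    exact h
  dsimp only
  set m := max ‖x‖ ‖y‖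
  have hxm : ‖x‖ ≤ m := le_max_left _ _
  have hym : ‖y‖ ≤ m := le_max_right _ _
  rcases (le_trans (norm_nonneg x) hxm).eq_or_lt with hm | hm
  · have hx0 : x = 0 := norm_le_zero_iff.1 (by rwa [← hm] at hxm)
    have hy0 : y = 0 := norm_le_zero_iff.1 (by rwa [← hm] at hym)
    simp [hx0, hy0, ← hm]
  have hmid := norm_midpoint_le_of_quadratic_modulus hσ hA hm (max_le (hΩ x hx) (hΩ y hy)) hxm hym
  have hsplit : l • x + (1 - l) • y = (2 * l) • ((2 : ℝ)⁻¹ • (x + y)) + (1 - 2 * l) • y := by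
    module
  have hK : 0 ≤ σ / (8 * M) * ‖x - y‖ ^ 2 := by positivity
  have heq : σ / (2 * M) / 2 * (l * (1 - l)) * ‖x - y‖ ^ 2 =
      2 * (l * (1 - l)) * (σ / (8 * M) * ‖x - y‖ ^ 2) := by
    field_simp
    ring
  calc ‖l • x + (1 - l) • y‖
      ≤ 2 * l * ‖(2 : ℝ)⁻¹ • (x + y)‖ + (1 - 2 * l) * ‖y‖ := by
        rw [hsplit]
        refine (norm_add_le _ _).trans_eq ?_
        rw [norm_smul (2 * l), norm_smul (1 - 2 * l), Real.norm_of_nonneg (by linarith),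
          Real.norm_of_nonneg (by linarith)]
    _ ≤ 2 * l * (m - σ / (8 * M) * ‖x - y‖ ^ 2) + (1 - 2 * l) * m :=
        add_le_add (mul_le_mul_of_nonneg_left hmid (by linarith))
          (mul_le_mul_of_nonneg_left hym (by linarith))
    _ ≤ m - σ / (2 * M) / 2 * (l * (1 - l)) * ‖x - y‖ ^ 2 := by
        rw [heq]
        nlinarith [mul_nonneg (sq_nonneg l) hK]

theorem stmt_13 {X : Type*} [NormedAddCommGroup X] [NormedSpace ℝ X] [CompleteSpace X]
    {σ : ℝ} (hσ : 0 < σ)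
    (hA : ∀ ε ∈ Set.Icc (0 : ℝ) 2, ∀ x y : X, ‖x‖ ≤ 1 → ‖y‖ ≤ 1 → ε ≤ ‖x - y‖ →
      ‖(2 : ℝ)⁻¹ • (x + y)‖ ≤ 1 - σ / 8 * ε ^ 2) :
    (SQuasiconvexOnR (σ / 2) (Metric.closedBall (0 : X) 1) fun x => ‖x‖) ∧
      (∀ (Ω : Set X) (M : ℝ), 0 < M → Ω.Nonempty → Convex ℝ Ω →
        (∀ x ∈ Ω, ‖x‖ ≤ M) → SQuasiconvexOnR (σ / (2 * M)) Ω fun x => ‖x‖) := by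
  refine ⟨?_, fun Ω M hM _ _ hΩ => sQuasiconvexOnR_norm_of_quadratic_modulus hσ hA hM hΩ⟩
  simpa using sQuasiconvexOnR_norm_of_quadratic_modulus hσ hA one_pos
    (Ω := Metric.closedBall (0 : X) 1) fun x hx => by simpa using hx
end

section
/- Let X be a real Banach space satisfying Assumption (A) for some σ > 0, and let 0 < a < 1. Then the function x ↦ ‖x‖^a is strongly quasiconvex on every nonempty bounded convex subset of X, i.e., for every nonempty bounded convex Ω ⊆ X there exists τ > 0 such that x ↦ ‖x‖^a is τ-strongly quasiconvex on Ω. -/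
/-- A quadratic midpoint estimate on the unit ball extends to all convex combinations. -/
theorem norm_combo_le_of_midpoint {X : Type*} [NormedAddCommGroup X] [NormedSpace ℝ X]
    {σ : ℝ} (hσ : 0 ≤ σ)
    (hA : ∀ ε ∈ Set.Icc (0 : ℝ) 2, ∀ x y : X, ‖x‖ ≤ 1 → ‖y‖ ≤ 1 → ε ≤ ‖x - y‖ →
      ‖(2 : ℝ)⁻¹ • (x + y)‖ ≤ 1 - σ / 8 * ε ^ 2)
    {x y : X} (hx : ‖x‖ ≤ 1) (hy : ‖y‖ ≤ 1) {l : ℝ} (hl0 : 0 ≤ l) (hl1 : l ≤ 1) :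
    ‖l • x + (1 - l) • y‖ ≤ 1 - σ / 4 * (l * (1 - l)) * ‖x - y‖ ^ 2 := by
  wlog hl : l ≤ 1 / 2 generalizing x y l
  · have h := this hy hx (l := 1 - l) (by linarith) (by linarith) (by linarith)
    rw [norm_sub_rev y x, sub_sub_cancel, add_comm] at h
    linarith
  have hd : ‖x - y‖ ≤ 2 := (norm_sub_le x y).trans (by linarith)
  have hmid := hA ‖x - y‖ ⟨norm_nonneg _, hd⟩ x y hx hy le_rfl
  have hz : l • x + (1 - l) • y = (2 * l) • ((2 : ℝ)⁻¹ • (x + y)) + (1 - 2 * l) • y := by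
    module
  have hn : ‖l • x + (1 - l) • y‖ ≤ 2 * l * ‖(2 : ℝ)⁻¹ • (x + y)‖ + (1 - 2 * l) * ‖y‖ := by
    rw [hz]
    refine (norm_add_le _ _).trans_eq ?_
    rw [norm_smul (2 * l), norm_smul (1 - 2 * l), Real.norm_of_nonneg (by linarith),
      Real.norm_of_nonneg (by linarith)]
  have h1 := mul_le_mul_of_nonneg_left hmid (by linarith : 0 ≤ 2 * l)
  have h2 := mul_le_mul_of_nonneg_left hy (by linarith : 0 ≤ 1 - 2 * l)
  have h3 : 0 ≤ σ / 4 * (l * l) * ‖x - y‖ ^ 2 := by positivity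
  linarith

/-- The scaled form of `norm_combo_le_of_midpoint` on the ball of radius `M`. -/
theorem norm_combo_le_mul_of_midpoint {X : Type*} [NormedAddCommGroup X] [NormedSpace ℝ X]
    {σ : ℝ} (hσ : 0 ≤ σ)
    (hA : ∀ ε ∈ Set.Icc (0 : ℝ) 2, ∀ x y : X, ‖x‖ ≤ 1 → ‖y‖ ≤ 1 → ε ≤ ‖x - y‖ →
      ‖(2 : ℝ)⁻¹ • (x + y)‖ ≤ 1 - σ / 8 * ε ^ 2)
    {x y : X} {M : ℝ} (hM : 0 < M) (hx : ‖x‖ ≤ M) (hy : ‖y‖ ≤ M)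
    {l : ℝ} (hl0 : 0 ≤ l) (hl1 : l ≤ 1) :
    ‖l • x + (1 - l) • y‖ ≤ M * (1 - σ / 4 * (l * (1 - l)) * (‖x - y‖ / M) ^ 2) := by
  have hs (v : X) : ‖M⁻¹ • v‖ = ‖v‖ / M := by
    rw [norm_smul, Real.norm_of_nonneg (inv_nonneg.2 hM.le), inv_mul_eq_div]
  have h := norm_combo_le_of_midpoint hσ hA (x := M⁻¹ • x) (y := M⁻¹ • y)
    (by rwa [hs, div_le_one hM]) (by rwa [hs, div_le_one hM]) hl0 hl1
  rw [← smul_sub, hs, smul_comm l, smul_comm (1 - l), ← smul_add, hs, div_le_iff₀ hM] at h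
  linarith


theorem stmt_14 {X : Type*} [NormedAddCommGroup X] [NormedSpace ℝ X] [CompleteSpace X]
    {σ : ℝ} (hσ : 0 < σ)
    (hA : ∀ ε ∈ Set.Icc (0 : ℝ) 2, ∀ x y : X, ‖x‖ ≤ 1 → ‖y‖ ≤ 1 → ε ≤ ‖x - y‖ →
      ‖(2 : ℝ)⁻¹ • (x + y)‖ ≤ 1 - σ / 8 * ε ^ 2)
    {a : ℝ} (ha0 : 0 < a) (ha1 : a < 1) :
    ∀ Ω : Set X, Ω.Nonempty → Convex ℝ Ω → Bornology.IsBounded Ω →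
      ∃ τ > 0, SQuasiconvexOnR τ Ω fun x => ‖x‖ ^ a := by
  intro Ω _ _ hb
  obtain ⟨R, hR, hΩ⟩ := hb.exists_pos_norm_le
  refine ⟨a * σ / 2 * R ^ (a - 2), by positivity, ?_⟩
  intro x hx y hy l hl0 hl1
  dsimp only
  obtain ⟨M, hM⟩ : ∃ M, M = max ‖x‖ ‖y‖ := ⟨_, rfl⟩
  have hxM : ‖x‖ ≤ M := hM ▸ le_max_left _ _
  have hyM : ‖y‖ ≤ M := hM ▸ le_max_right _ _
  have hMR : M ≤ R := hM ▸ max_le (hΩ x hx) (hΩ y hy)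
  have hmax : M ^ a ≤ max (‖x‖ ^ a) (‖y‖ ^ a) := by
    rcases max_choice ‖x‖ ‖y‖ with h | h <;> rw [hM, h]
    exacts [le_max_left _ _, le_max_right _ _]
  rcases ((norm_nonneg x).trans hxM).eq_or_lt with h0 | h0
  · have hx0 : x = 0 := norm_le_zero_iff.1 (h0 ▸ hxM)
    have hy0 : y = 0 := norm_le_zero_iff.1 (h0 ▸ hyM)
    simp [hx0, hy0]
  have hN := norm_combo_le_mul_of_midpoint hσ.le hA h0 hxM hyM hl0.le hl1.le
  set t := σ / 4 * (l * (1 - l)) * (‖x - y‖ / M) ^ 2 with ht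
  have ht1 : 0 ≤ 1 - t := nonneg_of_mul_nonneg_right ((norm_nonneg _).trans hN) h0
  have hbern : (1 - t) ^ a ≤ 1 - a * t := by
    have h := rpow_one_add_le_one_add_mul_self (s := -t) (by linarith) ha0.le ha1.le
    rwa [mul_neg, ← sub_eq_add_neg, ← sub_eq_add_neg] at h
  have hrad : R ^ (a - 2) ≤ M ^ (a - 2) :=
    Real.rpow_le_rpow_of_nonpos h0 hMR (by linarith)
  have hpow : M ^ (a - 2) = M ^ a / M ^ 2 := by
    rw [Real.rpow_sub h0, Real.rpow_two]
  have hl : 0 ≤ l * (1 - l) := mul_nonneg hl0.le (by linarith)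
  calc ‖l • x + (1 - l) • y‖ ^ a
      ≤ (M * (1 - t)) ^ a := Real.rpow_le_rpow (norm_nonneg _) hN ha0.le
    _ = M ^ a * (1 - t) ^ a := Real.mul_rpow h0.le ht1
    _ ≤ M ^ a * (1 - a * t) := by gcongr
    _ = M ^ a - a * σ / 4 * (l * (1 - l)) * ‖x - y‖ ^ 2 * M ^ (a - 2) := by
      rw [hpow, ht]
      field_simp
    _ ≤ M ^ a - a * σ / 4 * (l * (1 - l)) * ‖x - y‖ ^ 2 * R ^ (a - 2) := by gcongr
    _ ≤ max (‖x‖ ^ a) (‖y‖ ^ a) -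
        a * σ / 2 * R ^ (a - 2) / 2 * (l * (1 - l)) * ‖x - y‖ ^ 2 := by linarith
end

section
/- Let σ > 0, let X be a real normed vector space, let K ⊆ X be a nonempty, closed, convex set, and let f : K → ℝ be σ-strongly quasiconvex and lower semicontinuous at some point x₀ ∈ K. Then f is 2-supercoercive on K; in particular, there exist constants c > 0 and R > 0 such that f(y) ≥ f(x₀) + c‖y − x₀‖² for all y ∈ K with ‖y‖ > R. -/
open Classical in
/-- The extension of `f : K → ℝ` by `∞` outside `K`, used to define supercoercivity on `K`. -/
noncomputable def extByTop {X : Type*} (K : Set X) (f : X → ℝ) : X → EReal :=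
  fun x => if x ∈ K then (f x : EReal) else ⊤

/-- `g` is `n`-supercoercive if `liminf_{‖x‖ → ∞} g x / ‖x‖ ^ n > 0`. -/
def Supercoercive {X : Type*} [NormedAddCommGroup X] (n : ℕ) (g : X → EReal) : Prop :=
  0 < Filter.liminf (fun x => g x / ((‖x‖ ^ n : ℝ) : EReal))
      (Filter.comap (fun x : X => ‖x‖) Filter.atTop)

/-- Lower semicontinuity at a point bounds a strongly quasiconvex function from below by its
value there, far away from the point. -/
theorem SQuasiconvexOnR.exists_le_of_le_norm_sub {X : Type*} [NormedAddCommGroup X]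
    [NormedSpace ℝ X] {σ : ℝ} (hσ : 0 < σ) {K : Set X} (hKconv : Convex ℝ K) {f : X → ℝ}
    (hf : SQuasiconvexOnR σ K f) {x₀ : X} (hx₀ : x₀ ∈ K)
    (hlsc : LowerSemicontinuousWithinAt f K x₀) :
    ∃ D > 0, ∀ y ∈ K, D ≤ ‖y - x₀‖ → f x₀ ≤ f y := by
  have h := hlsc (f x₀ - 1) (by linarith)
  obtain ⟨δ, hδ, hball⟩ := Metric.mem_nhdsWithin_iff.1 h
  set r := δ / 2 with hr
  have hr0 : 0 < r := by positivity
  refine ⟨r + 2 / (σ * r), by positivity, fun y hy hd => ?_⟩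
  set d := ‖y - x₀‖ with hd'
  have hpos : 0 < 2 / (σ * r) := by positivity
  have hrd : r < d := by linarith
  have hd0 : 0 < d := hr0.trans hrd
  have hl0 : 0 < r / d := by positivity
  have hl1 : r / d < 1 := (div_lt_one hd0).2 hrd
  have hq := hf y hy x₀ hx₀ (r / d) hl0 hl1
  have hzK : (r / d) • y + (1 - r / d) • x₀ ∈ K :=
    hKconv hy hx₀ hl0.le (by linarith) (by ring)
  have hz : (r / d) • y + (1 - r / d) • x₀ ∈ Metric.ball x₀ δ := by
    have he : (r / d) • y + (1 - r / d) • x₀ - x₀ = (r / d) • (y - x₀) := by module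
    rw [mem_ball_iff_norm, he, norm_smul, Real.norm_of_nonneg hl0.le, ← hd',
      div_mul_cancel₀ _ hd0.ne']
    linarith
  have hlow : f x₀ - 1 < f ((r / d) • y + (1 - r / d) • x₀) := hball ⟨hz, hzK⟩
  have he : σ / 2 * (r / d * (1 - r / d)) * d ^ 2 = σ * r / 2 * (d - r) := by
    field_simp
  have hge : 1 ≤ σ * r / 2 * (d - r) := by
    calc (1 : ℝ) = σ * r / 2 * (2 / (σ * r)) := by field_simp
      _ ≤ σ * r / 2 * (d - r) := by gcongr; linarith
  rw [← hd', he] at hq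
  by_contra! hlt
  rw [max_eq_right hlt.le] at hq
  linarith

/-- A strongly quasiconvex function grows quadratically away from any point at which it is
lower semicontinuous. -/
theorem SQuasiconvexOnR.exists_add_sq_le {X : Type*} [NormedAddCommGroup X]
    [NormedSpace ℝ X] {σ : ℝ} (hσ : 0 < σ) {K : Set X} (hKconv : Convex ℝ K) {f : X → ℝ}
    (hf : SQuasiconvexOnR σ K f) {x₀ : X} (hx₀ : x₀ ∈ K)
    (hlsc : LowerSemicontinuousWithinAt f K x₀) :
    ∃ D > 0, ∀ y ∈ K, D ≤ ‖y - x₀‖ → f x₀ + σ / 8 * ‖y - x₀‖ ^ 2 ≤ f y := by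
  obtain ⟨D, hD, hle⟩ := hf.exists_le_of_le_norm_sub hσ hKconv hx₀ hlsc
  refine ⟨2 * D, by positivity, fun y hy hd => ?_⟩
  have hq := hf y hy x₀ hx₀ (1 / 2) (by norm_num) (by norm_num)
  have hmK : (1 / 2 : ℝ) • y + (1 - 1 / 2 : ℝ) • x₀ ∈ K :=
    hKconv hy hx₀ (by norm_num) (by norm_num) (by norm_num)
  have he : (1 / 2 : ℝ) • y + (1 - 1 / 2 : ℝ) • x₀ - x₀ = (1 / 2 : ℝ) • (y - x₀) := by module
  have hm := hle _ hmK (by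
    rw [he, norm_smul, Real.norm_of_nonneg (by norm_num)]
    linarith)
  rw [max_eq_left (hle y hy (by linarith))] at hq
  linarith

theorem supercoercive_extByTop_of_le {X : Type*} [NormedAddCommGroup X] {n : ℕ} {K : Set X}
    {f : X → ℝ} {c R : ℝ} (hc : 0 < c) (h : ∀ y ∈ K, R < ‖y‖ → c * ‖y‖ ^ n ≤ f y) :
    Supercoercive n (extByTop K f) := by
  refine lt_of_lt_of_le (EReal.coe_pos.2 hc) (Filter.le_liminf_of_le (by isBoundedDefault) ?_)
  filter_upwards [Filter.preimage_mem_comap (Filter.Ioi_mem_atTop (max R 0))] with x hx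
  obtain ⟨hxR, hx0⟩ := max_lt_iff.1 (show max R 0 < ‖x‖ from hx)
  have hpow : 0 < ‖x‖ ^ n := pow_pos hx0 n
  by_cases hxK : x ∈ K
  · rw [extByTop, if_pos hxK, ← EReal.coe_div, EReal.coe_le_coe_iff, le_div_iff₀ hpow]
    exact h x hxK hxR
  · rw [extByTop, if_neg hxK, EReal.top_div_of_pos_ne_top (EReal.coe_pos.2 hpow)
      (EReal.coe_ne_top _)]
    exact le_top

theorem stmt_16 {X : Type*} [NormedAddCommGroup X] [NormedSpace ℝ X]
    {σ : ℝ} (hσ : 0 < σ) {K : Set X} (hKne : K.Nonempty) (hKcl : IsClosed K)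
    (hKconv : Convex ℝ K) {f : X → ℝ} (hf : SQuasiconvexOnR σ K f)
    {x₀ : X} (hx₀ : x₀ ∈ K) (hlsc : LowerSemicontinuousWithinAt f K x₀) :
    Supercoercive 2 (extByTop K f) ∧
      ∃ c > 0, ∃ R > 0, ∀ y ∈ K, R < ‖y‖ → f x₀ + c * ‖y - x₀‖ ^ 2 ≤ f y := by
  obtain ⟨D, hD, hle⟩ := hf.exists_add_sq_le hσ hKconv hx₀ hlsc
  have hnorm (y : X) : ‖y‖ - ‖x₀‖ ≤ ‖y - x₀‖ := norm_sub_norm_le y x₀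
  have hx₀n := norm_nonneg x₀
  refine ⟨supercoercive_extByTop_of_le (c := σ / 64)
    (R := D + 2 * ‖x₀‖ + 1 + 64 * |f x₀| / σ) (by positivity) fun y hy hR => ?_,
    σ / 8, by positivity, D + ‖x₀‖, by positivity, fun y hy hR => ?_⟩
  · have hq : 0 ≤ 64 * |f x₀| / σ := by positivity
    have hn := hnorm y
    have hy1 : 1 ≤ ‖y‖ := by linarith
    have hgrow := hle y hy (by linarith)
    have hsq : (‖y‖ / 2) ^ 2 ≤ ‖y - x₀‖ ^ 2 := by
      gcongr
      linarith
    have hfx : 64 * |f x₀| ≤ ‖y‖ * σ := (div_le_iff₀ hσ).1 (by linarith)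
    have hyy : σ * ‖y‖ ≤ σ * ‖y‖ ^ 2 := by
      gcongr
      exact le_self_pow₀ hy1 two_ne_zero
    have habs := neg_abs_le (f x₀)
    have hmul : σ / 8 * (‖y‖ / 2) ^ 2 ≤ σ / 8 * ‖y - x₀‖ ^ 2 := by gcongr
    linarith
  · exact hle y hy (by linarith [hnorm y])
end

section
/- Let σ > 0, let X be a reflexive real Banach space (i.e., the canonical embedding of X into its bidual is surjective), let K ⊆ X be a nonempty, closed, convex set, and let f : K → ℝ be lower semicontinuous and σ-strongly quasiconvex. Then f attains its minimum on K at a unique point x̄, i.e., argmin_K(f) = {x̄}, and moreover f(x̄) + (σ/4)‖y − x̄‖² ≤ f(y) for every y ∈ K. -/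
open NormedSpace Metric Set

section Reflexive

variable {X : Type*} [NormedAddCommGroup X] [NormedSpace ℝ X]

theorem Convex.isClosed_image_toWeakSpace {S : Set X} (hconv : Convex ℝ S) (hcl : IsClosed S) :
    IsClosed (toWeakSpace ℝ X '' S) := by
  rw [← closure_eq_iff_isClosed, ← hconv.toWeakSpace_closure ℝ, hcl.closure_eq]

theorem isCompact_image_toWeakSpace_of_surjective
    (hrefl : Function.Surjective ⇑(inclusionInDoubleDual ℝ X)) {S : Set X}
    (hconv : Convex ℝ S) (hcl : IsClosed S) (hb : Bornology.IsBounded S) :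
    IsCompact (toWeakSpace ℝ X '' S) := by
  have hsurj : Function.Surjective ⇑(inclusionInDoubleDualWeak ℝ X) :=
    StrongDual.toWeakDual.surjective.comp (hrefl.comp (toWeakSpace ℝ X).symm.surjective)
  have h := isCompact_closure_of_isBounded ℝ X (toWeakSpace ℝ X '' S)
    (by rwa [preimage_image_eq _ (toWeakSpace ℝ X).injective])
    (by rw [hsurj.range_eq]; exact subset_univ _)
  rwa [(hconv.isClosed_image_toWeakSpace hcl).closure_eq] at h

/-- A lower semicontinuous quasiconvex function attains its minimum on a nonempty bounded closed
convex subset of a reflexive space. -/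
theorem QuasiconvexOn.exists_isMinOn_of_surjective
    (hrefl : Function.Surjective ⇑(inclusionInDoubleDual ℝ X)) {S : Set X} {f : X → ℝ}
    (hf : QuasiconvexOn ℝ S f) (hne : S.Nonempty) (hconv : Convex ℝ S) (hcl : IsClosed S)
    (hb : Bornology.IsBounded S) (hlsc : LowerSemicontinuousOn f S) :
    ∃ x ∈ S, ∀ y ∈ S, f x ≤ f y := by
  have hlsc' : LowerSemicontinuousOn (f ∘ (toWeakSpace ℝ X).symm) (toWeakSpace ℝ X '' S) := by
    rw [lowerSemicontinuousOn_iff_preimage_Iic] at hlsc ⊢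
    intro b
    obtain ⟨v, hv, hSv⟩ := hlsc b
    refine ⟨toWeakSpace ℝ X '' (S ∩ f ⁻¹' Iic b), ?_, ?_⟩
    · exact Convex.isClosed_image_toWeakSpace (hf b) (hSv ▸ hcl.inter hv)
    · ext w
      constructor
      · rintro ⟨⟨x, hx, rfl⟩, hxb⟩
        exact ⟨mem_image_of_mem _ hx, mem_image_of_mem _ ⟨hx, by simpa using hxb⟩⟩
      · rintro ⟨hw, x, ⟨-, hxb⟩, rfl⟩
        exact ⟨hw, by simpa using hxb⟩
  obtain ⟨-, ⟨x, hx, rfl⟩, hmin⟩ := hlsc'.exists_isMinOn (hne.image _)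
    (isCompact_image_toWeakSpace_of_surjective hrefl hconv hcl hb)
  refine ⟨x, hx, fun y hy => ?_⟩
  simpa using isMinOn_iff.1 hmin _ (mem_image_of_mem (toWeakSpace ℝ X) hy)

end Reflexive

namespace SQuasiconvexOnR

variable {X : Type*} [NormedAddCommGroup X] [NormedSpace ℝ X] {σ : ℝ} {K S : Set X} {f : X → ℝ}

theorem mono (hf : SQuasiconvexOnR σ K f) (hSK : S ⊆ K) : SQuasiconvexOnR σ S f :=
  fun x hx y hy => hf x (hSK hx) y (hSK hy)

theorem quasiconvexOn (hf : SQuasiconvexOnR σ K f) (hσ : 0 ≤ σ) (hK : Convex ℝ K) :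
    QuasiconvexOn ℝ K f := by
  intro r
  rw [convex_iff_forall_pos]
  rintro x ⟨hx, hxr⟩ y ⟨hy, hyr⟩ a b ha hb hab
  refine ⟨hK hx hy ha.le hb.le hab, ?_⟩
  obtain rfl : b = 1 - a := by linarith
  have h := hf x hx y hy a ha (by linarith)
  have h' : 0 ≤ σ / 2 * (a * (1 - a)) * ‖x - y‖ ^ 2 := by positivity
  linarith [max_le hxr hyr]

/-- A sublevel set of a strongly quasiconvex function is bounded as soon as the function is bounded
below near one of its points. -/
theorem norm_sub_le_of_forall_le (hf : SQuasiconvexOnR σ K f) (hσ : 0 < σ) (hK : Convex ℝ K)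
    {x y : X} (hx : x ∈ K) (hy : y ∈ K) {m : ℝ} (hm : ∀ z ∈ K ∩ closedBall x 1, m ≤ f z)
    (hyx : f y ≤ f x) : ‖y - x‖ ≤ 1 + 2 * (f x - m) / σ := by
  have hmx : m ≤ f x := hm x ⟨hx, mem_closedBall_self zero_le_one⟩
  rcases le_or_gt ‖y - x‖ 1 with h1 | h1
  · have : 0 ≤ 2 * (f x - m) / σ := div_nonneg (by linarith) hσ.le
    linarith
  set t := ‖y - x‖ with ht
  have ht0 : 0 < t := by linarith
  have hl1 : t⁻¹ < 1 := inv_lt_one_of_one_lt₀ h1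
  have hz : t⁻¹ • y + (1 - t⁻¹) • x ∈ K ∩ closedBall x 1 := by
    refine ⟨hK hy hx (by positivity) (by linarith) (by ring), ?_⟩
    have : t⁻¹ • y + (1 - t⁻¹) • x - x = t⁻¹ • (y - x) := by module
    rw [mem_closedBall, dist_eq_norm, this, norm_smul, Real.norm_of_nonneg (by positivity), ← ht,
      inv_mul_cancel₀ ht0.ne']
  have h := (hm _ hz).trans (hf y hy x hx t⁻¹ (by positivity) hl1)
  rw [max_eq_right hyx, ← ht] at h
  have h2 : σ / 2 * (t⁻¹ * (1 - t⁻¹)) * t ^ 2 = σ / 2 * (t - 1) := by field_simp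
  rw [h2] at h
  have : t - 1 ≤ 2 * (f x - m) / σ := by
    rw [le_div_iff₀ hσ]
    linarith
  linarith

theorem exists_forall_le_of_surjective
    (hrefl : Function.Surjective ⇑(inclusionInDoubleDual ℝ X)) (hf : SQuasiconvexOnR σ K f)
    (hσ : 0 < σ) (hne : K.Nonempty) (hcl : IsClosed K) (hK : Convex ℝ K)
    (hlsc : LowerSemicontinuousOn f K) : ∃ x ∈ K, ∀ y ∈ K, f x ≤ f y := by
  obtain ⟨x₀, hx₀⟩ := hne
  have hball : ∀ r : ℝ, 0 ≤ r →
      ∃ x ∈ K ∩ closedBall x₀ r, ∀ y ∈ K ∩ closedBall x₀ r, f x ≤ f y := fun r hr => by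
    have hconv := hK.inter (convex_closedBall x₀ r)
    exact ((hf.mono inter_subset_left).quasiconvexOn hσ.le hconv).exists_isMinOn_of_surjective
      hrefl ⟨x₀, hx₀, mem_closedBall_self hr⟩ hconv (hcl.inter isClosed_closedBall)
      (isBounded_closedBall.subset inter_subset_right) (hlsc.mono inter_subset_left)
  obtain ⟨z, -, hz⟩ := hball 1 zero_le_one
  have hzx : f z ≤ f x₀ := hz x₀ ⟨hx₀, mem_closedBall_self zero_le_one⟩
  have hR : 0 ≤ 1 + 2 * (f x₀ - f z) / σ :=
    add_nonneg zero_le_one (div_nonneg (by linarith) hσ.le)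
  obtain ⟨x, ⟨hxK, -⟩, hx⟩ := hball _ hR
  refine ⟨x, hxK, fun y hy => ?_⟩
  rcases le_total (f y) (f x₀) with h | h
  · exact hx y ⟨hy, mem_closedBall_iff_norm.2 (hf.norm_sub_le_of_forall_le hσ hK hx₀ hy hz h)⟩
  · exact (hx x₀ ⟨hx₀, mem_closedBall_self hR⟩).trans h

/-- A quadratic growth constant `c` at a minimizer improves to `c * s ^ 2 + σ / 2 * (s * (1 - s))`
for every `0 < s < 1`. -/
theorem quadratic_growth_improve (hf : SQuasiconvexOnR σ K f) (hK : Convex ℝ K) {x : X}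
    (hx : x ∈ K) (hmin : ∀ y ∈ K, f x ≤ f y) {c : ℝ}
    (hc : ∀ y ∈ K, f x + c * ‖y - x‖ ^ 2 ≤ f y) {s : ℝ} (hs0 : 0 < s) (hs1 : s < 1) :
    ∀ y ∈ K, f x + (c * s ^ 2 + σ / 2 * (s * (1 - s))) * ‖y - x‖ ^ 2 ≤ f y := by
  intro y hy
  have h := (hc _ (hK hy hx hs0.le (sub_nonneg.2 hs1.le) (by ring))).trans
    (hf y hy x hx s hs0 hs1)
  have hz : s • y + (1 - s) • x - x = s • (y - x) := by module
  rw [max_eq_left (hmin y hy), hz, norm_smul, Real.norm_of_nonneg hs0.le] at h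
  linarith

theorem quadratic_growth (hf : SQuasiconvexOnR σ K f) (hσ : 0 < σ) (hK : Convex ℝ K) {x : X}
    (hx : x ∈ K) (hmin : ∀ y ∈ K, f x ≤ f y) :
    ∀ y ∈ K, f x + σ / 4 * ‖y - x‖ ^ 2 ≤ f y := by
  intro y hy
  rcases eq_or_ne y x with rfl | hne
  · simp
  have hd : 0 < ‖y - x‖ ^ 2 := by
    have := norm_pos_iff.2 (sub_ne_zero.2 hne)
    positivity
  set C : Set ℝ := {c | ∀ y ∈ K, f x + c * ‖y - x‖ ^ 2 ≤ f y}
  have h0 : (0 : ℝ) ∈ C := fun y hy => by simpa using hmin y hy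
  have hub : ∀ c ∈ C, c ≤ (f y - f x) / ‖y - x‖ ^ 2 := fun c hc => by
    rw [le_div_iff₀ hd]
    linarith [hc y hy]
  have hbdd : BddAbove C := ⟨_, hub⟩
  have hnn : 0 ≤ sSup C := le_csSup hbdd h0
  have himp : ∀ s : ℝ, 0 < s → s < 1 → σ / 2 * s ≤ sSup C * (1 + s) := fun s hs0 hs1 => by
    have h : sSup C ≤ (sSup C - σ / 2 * (s * (1 - s))) / s ^ 2 := by
      refine csSup_le ⟨0, h0⟩ fun c hc => ?_
      rw [le_div_iff₀ (by positivity)]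
      linarith [le_csSup hbdd (hf.quadratic_growth_improve hK hx hmin hc hs0 hs1)]
    rw [le_div_iff₀ (by positivity)] at h
    refine le_of_mul_le_mul_right ?_ (sub_pos.2 hs1)
    linarith
  have hge : σ / 4 ≤ sSup C := by
    by_contra! hlt
    have hpos : 0 < σ / 2 - sSup C := by linarith
    have hq : sSup C / (σ / 2 - sSup C) < 1 := (div_lt_one hpos).2 (by linarith)
    obtain ⟨s, hs, hs1⟩ := exists_between hq
    have h := himp s ((div_nonneg hnn hpos.le).trans_lt hs) hs1
    rw [div_lt_iff₀ hpos] at hs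
    linarith
  have h := hge.trans (csSup_le ⟨0, h0⟩ hub)
  rw [le_div_iff₀ hd] at h
  linarith

end SQuasiconvexOnR

theorem stmt_17 {X : Type*} [NormedAddCommGroup X] [NormedSpace ℝ X] [CompleteSpace X]
    (hrefl : Function.Surjective ⇑(NormedSpace.inclusionInDoubleDual ℝ X))
    {σ : ℝ} (hσ : 0 < σ) {K : Set X} (hKne : K.Nonempty) (hKcl : IsClosed K)
    (hKconv : Convex ℝ K) {f : X → ℝ} (hlsc : LowerSemicontinuousOn f K)
    (hf : SQuasiconvexOnR σ K f) :
    ∃ xbar ∈ K, {x ∈ K | ∀ y ∈ K, f x ≤ f y} = {xbar} ∧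
      ∀ y ∈ K, f xbar + σ / 4 * ‖y - xbar‖ ^ 2 ≤ f y := by
  obtain ⟨x, hx, hmin⟩ := hf.exists_forall_le_of_surjective hrefl hσ hKne hKcl hKconv hlsc
  have hgrow := hf.quadratic_growth hσ hKconv hx hmin
  refine ⟨x, hx, Subset.antisymm ?_ (singleton_subset_iff.2 ⟨hx, hmin⟩), hgrow⟩
  rintro y ⟨hy, hymin⟩
  have h : σ / 4 * ‖y - x‖ ^ 2 ≤ 0 := by linarith [hgrow y hy, hymin x hx]
  have h' : ‖y - x‖ ^ 2 = 0 :=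
    le_antisymm (nonpos_of_mul_nonpos_right h (by positivity)) (sq_nonneg _)
  simpa [sub_eq_zero] using h'
end
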